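/- arXiv:1603.05949 — 4 statements merged into one kernel-verified Lean document; each statement's English description precedes it below -/
import Mathlib

section
/- Let λ, μ, q > 0, p > 0, let q⁻ ∈ (−μ,0) and q⁺ > 0 be the two real roots of pθ² + (pμ − λ − q)θ − qμ = 0, let A± = (μ + q±)/(q⁺ − q⁻), and let W^{(q)}(x) = p^{−1}(A₊ e^{q⁺x} − A₋ e^{q⁻x}). Then the third derivative of W^{(q)} is strictly positive on [0,∞), and if q⁻²(μ + q⁻) > q⁺²(μ + q⁺) then a* := (1/(q⁺ − q⁻))·log( q⁻²(μ + q⁻) / (q⁺²(μ + q⁺)) ) is strictly positive, is the unique zero of W^{(q)′′} on [0,∞), and W^{(q)′} is strictly decreasing on [0,a*] and strictly increasing on [a*,∞), attaining its global minimum uniquely at a*. -/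
open Real Set

theorem iteratedDeriv_const_mul_exp_sub_const_mul_exp (n : ℕ) (c d a b : ℝ) :
    iteratedDeriv n (fun x : ℝ => c * exp (a * x) - d * exp (b * x)) =
      fun x => c * a ^ n * exp (a * x) - d * b ^ n * exp (b * x) := by
  induction n with
  | zero => simp
  | succ n ih =>
    rw [iteratedDeriv_succ, ih]
    funext x
    have hexp (r : ℝ) : HasDerivAt (fun y : ℝ => exp (r * y)) (exp (r * x) * r) x := by
      simpa using ((hasDerivAt_id x).const_mul r).exp
    refine (((hexp a).const_mul (c * a ^ n)).sub
      ((hexp b).const_mul (d * b ^ n))).deriv.trans ?_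
    ring

/-- The sign of `P e^{ax} - M e^{bx}` changes at `log (M / P) / (a - b)`. -/
theorem const_mul_exp_lt_const_mul_exp_iff {P M a b x : ℝ} (hP : 0 < P) (hM : 0 < M)
    (hab : b < a) :
    P * exp (a * x) < M * exp (b * x) ↔ x < 1 / (a - b) * log (M / P) := by
  have hsplit : exp (a * x) = exp ((a - b) * x) * exp (b * x) := by
    rw [← exp_add]
    ring_nf
  rw [hsplit, ← mul_assoc, mul_lt_mul_iff_left₀ (exp_pos _), one_div_mul_eq_div,
    lt_div_iff₀ (sub_pos.2 hab), lt_log_iff_exp_lt (div_pos hM hP), lt_div_iff₀ hP,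
    mul_comm P, mul_comm x]

theorem const_mul_exp_eq_const_mul_exp_iff {P M a b x : ℝ} (hP : 0 < P) (hM : 0 < M)
    (hab : b < a) :
    P * exp (a * x) = M * exp (b * x) ↔ x = 1 / (a - b) * log (M / P) := by
  have hsplit : exp (a * x) = exp ((a - b) * x) * exp (b * x) := by
    rw [← exp_add]
    ring_nf
  rw [hsplit, ← mul_assoc, mul_left_inj' (exp_pos _).ne', one_div_mul_eq_div,
    eq_div_iff (sub_pos.2 hab).ne', mul_comm P, ← eq_div_iff hP.ne', mul_comm x]
  refine ⟨fun h => by rw [← h, log_exp], fun h => by rw [h, exp_log (div_pos hM hP)]⟩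

/-- For the `q`-scale function `W^{(q)}(x) = p⁻¹(A₊e^{q⁺x} − A₋e^{q⁻x})` of the
Cramér–Lundberg process with exponential claims, the third derivative is strictly positive on
`[0,∞)`; and if `q⁻²(μ+q⁻) > q⁺²(μ+q⁺)` then
`a* = (q⁺−q⁻)⁻¹ log(q⁻²(μ+q⁻)/(q⁺²(μ+q⁺)))` is positive, is the unique zero of `W^{(q)}''`
on `[0,∞)`, and `W^{(q)}'` strictly decreases on `[0,a*]`, strictly increases on `[a*,∞)`,
attaining its global minimum uniquely at `a*`. -/
theorem cramer_lundberg_exponential_optimal_barrier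
    (lam μ q p qminus qplus astar : ℝ)
    (hlam : 0 < lam) (hμ : 0 < μ) (hq : 0 < q) (hp : 0 < p)
    (hqm : qminus ∈ Set.Ioo (-μ) 0) (hqp : 0 < qplus)
    (hrootm : p * qminus ^ 2 + (p * μ - lam - q) * qminus - q * μ = 0)
    (hrootp : p * qplus ^ 2 + (p * μ - lam - q) * qplus - q * μ = 0)
    (W : ℝ → ℝ)
    (hW : ∀ x : ℝ, W x = p⁻¹ * ((μ + qplus) / (qplus - qminus) * Real.exp (qplus * x) -
      (μ + qminus) / (qplus - qminus) * Real.exp (qminus * x)))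
    (ha : astar = 1 / (qplus - qminus) *
      Real.log (qminus ^ 2 * (μ + qminus) / (qplus ^ 2 * (μ + qplus)))) :
    (∀ x : ℝ, 0 ≤ x → 0 < iteratedDeriv 3 W x) ∧
    (qplus ^ 2 * (μ + qplus) < qminus ^ 2 * (μ + qminus) →
      0 < astar ∧
      (∀ x : ℝ, 0 ≤ x → (iteratedDeriv 2 W x = 0 ↔ x = astar)) ∧
      StrictAntiOn (deriv W) (Set.Icc 0 astar) ∧
      StrictMonoOn (deriv W) (Set.Ici astar) ∧
      (∀ x : ℝ, 0 ≤ x → x ≠ astar → deriv W astar < deriv W x)) := by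
  obtain ⟨hm₁, hm₂⟩ := hqm
  have hgap : 0 < qplus - qminus := by linarith
  have hlt : qminus < qplus := by linarith
  have hAp : 0 < μ + qplus := by linarith
  have hAm : 0 < μ + qminus := by linarith
  have hP : 0 < qplus ^ 2 * (μ + qplus) := by positivity
  have hM : 0 < qminus ^ 2 * (μ + qminus) := mul_pos (sq_pos_of_neg hm₂) hAm
  have hK : 0 < p⁻¹ / (qplus - qminus) := by positivity
  have hWeq : W = fun x => p⁻¹ / (qplus - qminus) * (μ + qplus) * exp (qplus * x) -
      p⁻¹ / (qplus - qminus) * (μ + qminus) * exp (qminus * x) := by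
    funext x
    rw [hW]
    ring
  have hderiv (n : ℕ) (x : ℝ) : iteratedDeriv n W x =
      p⁻¹ / (qplus - qminus) * (qplus ^ n * (μ + qplus) * exp (qplus * x) -
        qminus ^ n * (μ + qminus) * exp (qminus * x)) := by
    rw [hWeq, iteratedDeriv_const_mul_exp_sub_const_mul_exp]
    ring
  have hsecond (x : ℝ) : deriv (deriv W) x = iteratedDeriv 2 W x := by
    rw [iteratedDeriv_succ, iteratedDeriv_one]
  have hcont : Continuous (deriv W) := by
    rw [← iteratedDeriv_one, funext (hderiv 1)]
    fun_prop
  have hzero (x : ℝ) : iteratedDeriv 2 W x = 0 ↔ x = astar := by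
    rw [hderiv, mul_eq_zero, or_iff_right hK.ne', sub_eq_zero,
      const_mul_exp_eq_const_mul_exp_iff hP hM hlt, ← ha]
  have hneg (x : ℝ) : iteratedDeriv 2 W x < 0 ↔ x < astar := by
    rw [hderiv, ← mul_zero (p⁻¹ / (qplus - qminus)), mul_lt_mul_iff_right₀ hK, sub_neg,
      const_mul_exp_lt_const_mul_exp_iff hP hM hlt, ← ha]
  have hpos (x : ℝ) (hx : astar < x) : 0 < iteratedDeriv 2 W x :=
    lt_of_le_of_ne (not_lt.1 fun h => hx.not_gt ((hneg x).1 h))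
      fun h => hx.ne' ((hzero x).1 h.symm)
  refine ⟨fun x _ => ?_, fun h => ?_⟩
  · rw [hderiv]
    have hcube : qminus ^ 3 < 0 := Odd.pow_neg (by decide) hm₂
    have hleft : 0 < qplus ^ 3 * (μ + qplus) * exp (qplus * x) := by positivity
    have hright : qminus ^ 3 * (μ + qminus) * exp (qminus * x) < 0 :=
      mul_neg_of_neg_of_pos (mul_neg_of_neg_of_pos hcube hAm) (exp_pos _)
    exact mul_pos hK (by linarith)
  have hastar : 0 < astar := by
    rw [ha]
    exact mul_pos (one_div_pos.2 hgap) (log_pos ((one_lt_div hP).2 h))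
  have hanti : StrictAntiOn (deriv W) (Icc 0 astar) := by
    refine strictAntiOn_of_deriv_neg (convex_Icc _ _) hcont.continuousOn fun x hx => ?_
    rw [interior_Icc] at hx
    rw [hsecond]
    exact (hneg x).2 hx.2
  have hmono : StrictMonoOn (deriv W) (Ici astar) := by
    refine strictMonoOn_of_deriv_pos (convex_Ici _) hcont.continuousOn fun x hx => ?_
    rw [interior_Ici] at hx
    rw [hsecond]
    exact hpos x hx
  refine ⟨hastar, fun x _ => hzero x, hanti, hmono, fun x hx hne => ?_⟩
  rcases hne.lt_or_gt with hxa | hax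
  · exact hanti ⟨hx, hxa.le⟩ ⟨hastar.le, le_rfl⟩ hxa
  · exact hmono self_mem_Ici hax.le hax
end

section
/- Let ρ : (0,∞) → (0,∞) be log-convex (i.e. log ∘ ρ is convex) and measurable, and suppose ∫_x^∞ ρ(y) dy < ∞ for every x > 0. Then the tail function N(x) := ∫_x^∞ ρ(y) dy is strictly positive and log-convex on (0,∞). -/
open MeasureTheory Real Set

/-- Translating the variable turns a tail integral into an integral over `(0,∞)`. -/
lemma setIntegral_Ioi_eq_translate (f : ℝ → ℝ) (x : ℝ) :
    ∫ y in Set.Ioi x, f y = ∫ t in Set.Ioi 0, f (x + t) := by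
  have h := (measurePreserving_add_left volume x).setIntegral_preimage_emb
    (measurableEmbedding_addLeft x) f (Set.Ioi x)
  simpa using h.symm

lemma MeasureTheory.IntegrableOn.translate_Ioi {f : ℝ → ℝ} {x : ℝ} (hf : IntegrableOn f (Set.Ioi x)) :
    IntegrableOn (fun t => f (x + t)) (Set.Ioi 0) := by
  have h := (measurePreserving_add_left volume x).integrableOn_comp_preimage
    (measurableEmbedding_addLeft x) (f := f) (s := Set.Ioi x)
  simpa [Function.comp_def] using h.2 hf

/-- A function that is positive and integrable on a half-line has positive integral there. -/
lemma setIntegral_Ioi_pos {f : ℝ → ℝ} {x : ℝ} (hpos : ∀ y ∈ Set.Ioi x, 0 < f y)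
    (hf : IntegrableOn f (Set.Ioi x)) : 0 < ∫ y in Set.Ioi x, f y := by
  rw [setIntegral_pos_iff_support_of_nonneg_ae
    (ae_restrict_of_forall_mem measurableSet_Ioi fun y hy => (hpos y hy).le) hf]
  have hsub : Set.Ioi x ⊆ Function.support f ∩ Set.Ioi x :=
    fun y hy => ⟨(hpos y hy).ne', hy⟩
  exact lt_of_lt_of_le (by simp) (measure_mono hsub)

/-- If `h` is dominated by a weighted geometric mean of `f` and `g`, then the integral of `h` is
dominated by the corresponding geometric mean of the integrals of `f` and `g`. -/
lemma setIntegral_le_rpow_mul_rpow {α : Type*} [MeasurableSpace α] {μ : Measure α} {s : Set α}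
    (hs : MeasurableSet s) {f g h : α → ℝ} {a b : ℝ} (ha : 0 ≤ a) (hb : 0 ≤ b) (hab : a + b = 1)
    (hf : IntegrableOn f s μ) (hg : IntegrableOn g s μ) (hh : IntegrableOn h s μ)
    (hf0 : ∀ t ∈ s, 0 ≤ f t) (hg0 : ∀ t ∈ s, 0 ≤ g t)
    (hF : 0 < ∫ t in s, f t ∂μ) (hG : 0 < ∫ t in s, g t ∂μ)
    (hle : ∀ t ∈ s, h t ≤ f t ^ a * g t ^ b) :
    ∫ t in s, h t ∂μ ≤ (∫ t in s, f t ∂μ) ^ a * (∫ t in s, g t ∂μ) ^ b := by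
  set F := ∫ t in s, f t ∂μ with hFdef
  set G := ∫ t in s, g t ∂μ with hGdef
  have hFa : 0 < F ^ a := rpow_pos_of_pos hF a
  have hGb : 0 < G ^ b := rpow_pos_of_pos hG b
  have hbound : ∀ t ∈ s, h t ≤ F ^ a * G ^ b * (a / F * f t + b / G * g t) := by
    intro t ht
    have hamgm := geom_mean_le_arith_mean2_weighted ha hb
      (div_nonneg (hf0 t ht) hF.le) (div_nonneg (hg0 t ht) hG.le) hab
    rw [div_rpow (hf0 t ht) hF.le, div_rpow (hg0 t ht) hG.le] at hamgm
    calc h t ≤ f t ^ a * g t ^ b := hle t ht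
      _ = F ^ a * G ^ b * (f t ^ a / F ^ a * (g t ^ b / G ^ b)) := by field_simp
      _ ≤ F ^ a * G ^ b * (a * (f t / F) + b * (g t / G)) := by gcongr
      _ = F ^ a * G ^ b * (a / F * f t + b / G * g t) := by ring
  have hfa : IntegrableOn (fun t => a / F * f t) s μ := Integrable.const_mul hf _
  have hgb : IntegrableOn (fun t => b / G * g t) s μ := Integrable.const_mul hg _
  calc ∫ t in s, h t ∂μ
      ≤ ∫ t in s, F ^ a * G ^ b * (a / F * f t + b / G * g t) ∂μ :=
        setIntegral_mono_on hh (Integrable.const_mul (hfa.add hgb) _) hs hbound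
    _ = F ^ a * G ^ b * (a / F * F + b / G * G) := by
        rw [integral_const_mul, integral_add hfa hgb, integral_const_mul, integral_const_mul]
    _ = F ^ a * G ^ b := by
        rw [div_mul_cancel₀ _ hF.ne', div_mul_cancel₀ _ hG.ne', hab, mul_one]

/-- Multiplicative form of log-convexity. -/
lemma le_rpow_mul_rpow_of_convexOn_log {f : ℝ → ℝ} {s : Set ℝ} (hpos : ∀ x ∈ s, 0 < f x)
    (hf : ConvexOn ℝ s (fun x => Real.log (f x))) {x y a b : ℝ} (hx : x ∈ s) (hy : y ∈ s)
    (ha : 0 ≤ a) (hb : 0 ≤ b) (hab : a + b = 1) :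
    f (a * x + b * y) ≤ f x ^ a * f y ^ b := by
  have hz : a * x + b * y ∈ s := hf.1 hx hy ha hb hab
  have hlog := hf.2 hx hy ha hb hab
  simp only [smul_eq_mul] at hlog
  have hxa := rpow_pos_of_pos (hpos x hx) a
  have hyb := rpow_pos_of_pos (hpos y hy) b
  rwa [← log_le_log_iff (hpos _ hz) (mul_pos hxa hyb), log_mul hxa.ne' hyb.ne',
    log_rpow (hpos x hx), log_rpow (hpos y hy)]

/-- If a measurable density `ρ : (0,∞) → (0,∞)` is log-convex and its tails are integrable,
then the tail function `N(x) = ∫_x^∞ ρ(y) dy` is strictly positive and log-convex on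
`(0,∞)`. -/
theorem tail_of_logconvex_density_logconvex
    (ρ : ℝ → ℝ) (hpos : ∀ x : ℝ, 0 < x → 0 < ρ x) (hmeas : Measurable ρ)
    (hlogconv : ConvexOn ℝ (Set.Ioi 0) (fun x => Real.log (ρ x)))
    (hint : ∀ x : ℝ, 0 < x → IntegrableOn ρ (Set.Ioi x)) :
    (∀ x : ℝ, 0 < x → 0 < ∫ y in Set.Ioi x, ρ y) ∧
    ConvexOn ℝ (Set.Ioi 0) (fun x => Real.log (∫ y in Set.Ioi x, ρ y)) := by
  have htail : ∀ x : ℝ, 0 < x → 0 < ∫ y in Set.Ioi x, ρ y := fun x hx =>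
    setIntegral_Ioi_pos (fun y hy => hpos y (hx.trans hy)) (hint x hx)
  refine ⟨htail, convex_Ioi 0, fun x hx y hy a b ha hb hab => ?_⟩
  have hz : 0 < a * x + b * y := convex_Ioi (0 : ℝ) hx hy ha hb hab
  rw [Set.mem_Ioi] at hx hy
  simp only [smul_eq_mul]
  have hX := htail x hx
  have hY := htail y hy
  have hXa := rpow_pos_of_pos hX a
  have hYb := rpow_pos_of_pos hY b
  rw [← log_rpow hX, ← log_rpow hY, ← log_mul hXa.ne' hYb.ne']
  refine log_le_log (htail _ hz) ?_
  rw [setIntegral_Ioi_eq_translate ρ x] at hX ⊢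
  rw [setIntegral_Ioi_eq_translate ρ y] at hY ⊢
  rw [setIntegral_Ioi_eq_translate ρ (a * x + b * y)]
  refine setIntegral_le_rpow_mul_rpow measurableSet_Ioi ha hb hab
    (hint x hx).translate_Ioi (hint y hy).translate_Ioi (hint _ hz).translate_Ioi
    (fun t ht => (hpos _ (add_pos hx ht)).le) (fun t ht => (hpos _ (add_pos hy ht)).le)
    hX hY fun t ht => ?_
  have hsplit : a * x + b * y + t = a * (x + t) + b * (y + t) := by
    linear_combination (-t) * hab
  rw [hsplit]
  exact le_rpow_mul_rpow_of_convexOn_log hpos hlogconv (add_pos hx ht) (add_pos hy ht) ha hb hab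
end

section
/- Let g : (0,∞) → (0,∞) be log-convex and measurable, let c ≥ 0, and suppose ∫_x^∞ e^{−cy} g(y) dy < ∞ for every x > 0. Then the function Υ(x) := e^{cx} ∫_x^∞ e^{−cy} g(y) dy is strictly positive and log-convex on (0,∞). -/
open MeasureTheory Real Set

/-- An integral of log-convex functions over a parameter space is log-convex. -/
theorem convexOn_log_integral {α E : Type*} [MeasurableSpace α] [AddCommGroup E] [Module ℝ E]
    {μ : Measure α} {s : Set E} {f : E → α → ℝ} (hs : Convex ℝ s)
    (hpos : ∀ x ∈ s, ∀ᵐ t ∂μ, 0 < f x t)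
    (hconv : ∀ᵐ t ∂μ, ConvexOn ℝ s (fun x => Real.log (f x t)))
    (hint : ∀ x ∈ s, Integrable (f x) μ) (hI : ∀ x ∈ s, 0 < ∫ t, f x t ∂μ) :
    ConvexOn ℝ s (fun x => Real.log (∫ t, f x t ∂μ)) := by
  refine ⟨hs, fun x hx y hy a b ha hb hab => ?_⟩
  have hz := hs hx hy ha hb hab
  have hIx := hI x hx
  have hIy := hI y hy
  set I := ∫ t, f x t ∂μ with hI_def
  set J := ∫ t, f y t ∂μ with hJ_def
  have hIJ : 0 < I ^ a * J ^ b := mul_pos (rpow_pos_of_pos hIx a) (rpow_pos_of_pos hIy b)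
  have key : ∫ t, f (a • x + b • y) t ∂μ ≤
      ∫ t, I ^ a * J ^ b * (a * (f x t / I) + b * (f y t / J)) ∂μ := by
    refine integral_mono_ae (hint _ hz)
      (((((hint x hx).div_const I).const_mul a).add
        (((hint y hy).div_const J).const_mul b)).const_mul _) ?_
    filter_upwards [hpos x hx, hpos y hy, hpos _ hz, hconv] with t hxt hyt hzt hct
    have h1 : f (a • x + b • y) t ≤ f x t ^ a * f y t ^ b := by
      rw [← Real.log_le_log_iff hzt (by positivity), Real.log_mul (by positivity) (by positivity),
        Real.log_rpow hxt, Real.log_rpow hyt]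
      exact hct.2 hx hy ha hb hab
    have h2 : f x t ^ a * f y t ^ b = I ^ a * J ^ b * ((f x t / I) ^ a * (f y t / J) ^ b) := by
      rw [Real.div_rpow hxt.le hIx.le, Real.div_rpow hyt.le hIy.le]
      have := (rpow_pos_of_pos hIx a).ne'
      have := (rpow_pos_of_pos hIy b).ne'
      field_simp
    refine h1.trans (h2.trans_le (mul_le_mul_of_nonneg_left ?_ hIJ.le))
    exact Real.geom_mean_le_arith_mean2_weighted ha hb (by positivity) (by positivity) hab
  have hval : ∫ t, I ^ a * J ^ b * (a * (f x t / I) + b * (f y t / J)) ∂μ = I ^ a * J ^ b := by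
    rw [integral_const_mul, integral_add (((hint x hx).div_const I).const_mul a)
        (((hint y hy).div_const J).const_mul b), integral_const_mul, integral_const_mul,
      integral_div, integral_div, ← hI_def, ← hJ_def, div_self hIx.ne', div_self hIy.ne',
      mul_one, mul_one, hab, mul_one]
  rw [hval] at key
  have hlog := Real.log_le_log (hI _ hz) key
  rwa [Real.log_mul (rpow_pos_of_pos hIx a).ne' (rpow_pos_of_pos hIy b).ne',
    Real.log_rpow hIx, Real.log_rpow hIy] at hlog

/-- If `g : (0,∞) → (0,∞)` is measurable and log-convex, `c ≥ 0`, and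
`∫_x^∞ e^{−cy} g(y) dy < ∞` for every `x > 0`, then
`Υ(x) = e^{cx} ∫_x^∞ e^{−cy} g(y) dy` is strictly positive and log-convex on `(0,∞)`. -/
theorem exponentially_tilted_tail_logconvex
    (g : ℝ → ℝ) (c : ℝ) (hc : 0 ≤ c)
    (hpos : ∀ x : ℝ, 0 < x → 0 < g x) (hmeas : Measurable g)
    (hlogconv : ConvexOn ℝ (Set.Ioi 0) (fun x => Real.log (g x)))
    (hint : ∀ x : ℝ, 0 < x → IntegrableOn (fun y => Real.exp (-c * y) * g y) (Set.Ioi x)) :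
    (∀ x : ℝ, 0 < x →
      0 < Real.exp (c * x) * ∫ y in Set.Ioi x, Real.exp (-c * y) * g y) ∧
    ConvexOn ℝ (Set.Ioi 0)
      (fun x => Real.log (Real.exp (c * x) * ∫ y in Set.Ioi x, Real.exp (-c * y) * g y)) := by
  have hΥpos : ∀ x : ℝ, 0 < x →
      0 < Real.exp (c * x) * ∫ y in Set.Ioi x, Real.exp (-c * y) * g y := by
    intro x hx
    have hpt : ∀ y ∈ Ioi x, 0 < Real.exp (-c * y) * g y := fun y hy =>
      mul_pos (Real.exp_pos _) (hpos y (hx.trans hy))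
    refine mul_pos (Real.exp_pos _) ?_
    rw [setIntegral_pos_iff_support_of_nonneg_ae
      (ae_restrict_of_forall_mem measurableSet_Ioi fun y hy => (hpt y hy).le) (hint x hx),
      inter_eq_right.2 fun y hy => Function.mem_support.2 (hpt y hy).ne', Real.volume_Ioi]
    exact ENNReal.zero_lt_top
  refine ⟨hΥpos, ?_⟩
  have hpre : ∀ x : ℝ, (fun t => x + t) ⁻¹' Ioi x = Ioi 0 := fun x => by simp
  have hshift : ∀ x t : ℝ, Real.exp (c * x) * (Real.exp (-c * (x + t)) * g (x + t)) =
      Real.exp (-c * t) * g (x + t) := fun x t => by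
    rw [← mul_assoc, ← Real.exp_add]; ring_nf
  have hΥ : ∀ x : ℝ, Real.exp (c * x) * ∫ y in Set.Ioi x, Real.exp (-c * y) * g y =
      ∫ t in Ioi 0, Real.exp (-c * t) * g (x + t) := fun x => by
    rw [← (measurePreserving_add_left volume x).setIntegral_preimage_emb
      (measurableEmbedding_addLeft x), hpre, ← integral_const_mul]
    simp only [hshift]
  have hΥint : ∀ x : ℝ, 0 < x →
      IntegrableOn (fun t => Real.exp (-c * t) * g (x + t)) (Ioi 0) := fun x hx => by
    have h := ((measurePreserving_add_left volume x).integrableOn_comp_preimage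
      (measurableEmbedding_addLeft x)).2 (hint x hx)
    rw [hpre] at h
    refine (h.const_mul (Real.exp (c * x))).congr (.of_forall fun t => hshift x t)
  simp only [hΥ] at hΥpos ⊢
  refine convexOn_log_integral (convex_Ioi 0) (fun x hx => ?_) ?_ hΥint hΥpos
  · exact ae_restrict_of_forall_mem measurableSet_Ioi fun t ht =>
      mul_pos (Real.exp_pos _) (hpos _ (add_pos hx ht))
  · refine ae_restrict_of_forall_mem measurableSet_Ioi fun t ht => ?_
    have hsub : ConvexOn ℝ (Ioi 0) (fun x => Real.log (g (x + t))) :=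
      (hlogconv.translate_left t).subset (fun x hx => mem_preimage.2 (mem_Ioi.2 (add_pos ht hx)))
        (convex_Ioi 0)
    refine (hsub.add_const (-c * t)).congr fun x hx => ?_
    simp only [Pi.add_apply]
    rw [Real.log_mul (Real.exp_pos _).ne' (hpos _ (add_pos hx ht)).ne', Real.log_exp, add_comm]
end

section
/- Let σ > 0, η > 0, q > 0, δ = σ^{−2}√(η² + 2qσ²), ω = η/σ², W^{(q)}(y) = (1/(σ²δ))(e^{(δ−ω)y} − e^{−(δ+ω)y}), and a* = (1/δ)·log((δ+ω)/(δ−ω)). Then: (i) (σ²/2)W^{(q)′′}(y) + ηW^{(q)′}(y) − qW^{(q)}(y) = 0 for all y ≥ 0 with W^{(q)}(0) = 0; (ii) q·W^{(q)}(a*) = η·W^{(q)′}(a*) (smooth-fit identity); and (iii) for every x ≥ a*, η − q·( x − a* + W^{(q)}(a*)/W^{(q)′}(a*) ) ≤ 0. -/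
open Real Set

/-- Derivative of a multiple of the difference of two exponentials. -/
theorem hasDerivAt_const_mul_exp_sub_exp (c a b k l y : ℝ) :
    HasDerivAt (fun y => c * (k * exp (a * y) - l * exp (b * y)))
      (c * ((k * a) * exp (a * y) - (l * b) * exp (b * y))) y := by
  have h (r : ℝ) : HasDerivAt (fun y => exp (r * y)) (exp (r * y) * r) y := by
    simpa using ((hasDerivAt_id y).const_mul r).exp
  refine ((((h a).const_mul k).fun_sub ((h b).const_mul l)).const_mul c).congr_deriv ?_
  ring

/-- Verification identities for the barrier strategy at `a*` for linear Brownian motion: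
the `q`-scale function solves `(σ²/2)W'' + ηW' − qW = 0` with `W(0) = 0`, the smooth-fit
identity `qW(a*) = ηW'(a*)` holds, and the HJB inequality
`η − q(x − a* + W(a*)/W'(a*)) ≤ 0` holds for all `x ≥ a*`. -/
theorem barrier_strategy_verification_identities
    (σ η q δ ω astar : ℝ) (hσ : 0 < σ) (hη : 0 < η) (hq : 0 < q)
    (hδ : δ = Real.sqrt (η ^ 2 + 2 * q * σ ^ 2) / σ ^ 2)
    (hω : ω = η / σ ^ 2)
    (W : ℝ → ℝ)
    (hW : ∀ y : ℝ, W y = 1 / (σ ^ 2 * δ) * (Real.exp ((δ - ω) * y) - Real.exp (-(δ + ω) * y)))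
    (ha : astar = 1 / δ * Real.log ((δ + ω) / (δ - ω))) :
    (∀ y : ℝ, 0 ≤ y →
      σ ^ 2 / 2 * iteratedDeriv 2 W y + η * deriv W y - q * W y = 0) ∧
    W 0 = 0 ∧
    q * W astar = η * deriv W astar ∧
    (∀ x : ℝ, astar ≤ x →
      η - q * (x - astar + W astar / deriv W astar) ≤ 0) := by
  have hσ2 : 0 < σ ^ 2 := by positivity
  have hδpos : 0 < δ := hδ ▸ by positivity
  have hωpos : 0 < ω := hω ▸ by positivity
  have hη' : η = ω * σ ^ 2 := by rw [hω]; field_simp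
  have hq' : 2 * q = σ ^ 2 * (δ ^ 2 - ω ^ 2) := by
    rw [hδ, hω, div_pow, div_pow, Real.sq_sqrt (by positivity)]
    field_simp
    ring
  have hωδ : ω < δ := by
    have : 0 < δ ^ 2 - ω ^ 2 := pos_of_mul_pos_right (by linarith) hσ2.le
    nlinarith
  have hsub : 0 < δ - ω := sub_pos.mpr hωδ
  have hadd : 0 < δ + ω := add_pos hδpos hωpos
  set c := 1 / (σ ^ 2 * δ)
  have hcpos : 0 < c := by positivity
  have hWeq : W = fun y => c * (1 * exp ((δ - ω) * y) - 1 * exp (-(δ + ω) * y)) := by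
    funext y
    simp [hW]
  have hW1 : deriv W = fun y => c * ((1 * (δ - ω)) * exp ((δ - ω) * y)
      - (1 * -(δ + ω)) * exp (-(δ + ω) * y)) := by
    funext y
    rw [hWeq]
    exact (hasDerivAt_const_mul_exp_sub_exp _ _ _ _ _ y).deriv
  have hW2 (y : ℝ) : iteratedDeriv 2 W y = c * ((1 * (δ - ω) * (δ - ω)) * exp ((δ - ω) * y)
      - (1 * -(δ + ω) * -(δ + ω)) * exp (-(δ + ω) * y)) := by
    rw [iteratedDeriv_succ, iteratedDeriv_one, hW1]
    exact (hasDerivAt_const_mul_exp_sub_exp _ _ _ _ _ y).deriv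
  have hode (y : ℝ) : σ ^ 2 / 2 * iteratedDeriv 2 W y + η * deriv W y - q * W y = 0 := by
    rw [hW2, hW1, hW, hη']
    linear_combination (-c / 2 * (exp ((δ - ω) * y) - exp (-(δ + ω) * y))) * hq'
  have hexp : (δ - ω) ^ 2 * exp ((δ - ω) * astar) = (δ + ω) ^ 2 * exp (-(δ + ω) * astar) := by
    have hda : exp (δ * astar) = (δ + ω) / (δ - ω) := by
      rw [ha, ← mul_assoc, mul_one_div_cancel hδpos.ne', one_mul, exp_log (by positivity)]
    have hsplit : exp ((δ - ω) * astar)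
        = exp (δ * astar) * exp (δ * astar) * exp (-(δ + ω) * astar) := by
      rw [← exp_add, ← exp_add]
      congr 1
      ring
    rw [hsplit, hda]
    field_simp
  have hinfl : iteratedDeriv 2 W astar = 0 := by
    rw [hW2]
    linear_combination c * hexp
  have hfit : q * W astar = η * deriv W astar := by
    have h := hode astar
    rw [hinfl] at h
    linarith
  have hW1pos : 0 < deriv W astar := by
    simp only [hW1, one_mul, neg_mul, sub_neg_eq_add]
    positivity
  refine ⟨fun y _ => hode y, by simp [hW], hfit, fun x hx => ?_⟩
  have hratio : q * (W astar / deriv W astar) = η := by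
    rw [← mul_div_assoc, hfit, mul_div_cancel_right₀ _ hW1pos.ne']
  nlinarith [mul_nonneg hq.le (sub_nonneg.mpr hx)]
end
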